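/- arXiv:1807.02856 — 3 statements merged into one kernel-verified Lean document; each statement's English description precedes it below -/
import Mathlib

section
/- Let V be a type and r : V → V → Prop a directed edge relation. Call a vertex u a root if for every vertex v there is a directed path (reflexive-transitive closure of r) from u to v. If u and v are both roots, then there is a directed path from u to v all of whose edges join root vertices; that is, Relation.ReflTransGen (fun a b => (a is a root) ∧ (b is a root) ∧ r a b) u v holds. (In particular, the subgraph induced by the root nodes is strongly connected.) -/
/-- If `u` and `v` are both roots (every vertex is reachable from them via the
reflexive-transitive closure of the edge relation `r`), then there is a directed
path from `u` to `v` all of whose edges join root vertices. -/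
theorem stmt_0 {V : Type*} (r : V → V → Prop) (u v : V)
    (hu : ∀ w, Relation.ReflTransGen r u w)
    (hv : ∀ w, Relation.ReflTransGen r v w) :
    Relation.ReflTransGen
      (fun a b => (∀ w, Relation.ReflTransGen r a w) ∧
                  (∀ w, Relation.ReflTransGen r b w) ∧ r a b) u v := by
  induction hu v using Relation.ReflTransGen.head_induction_on with
  | refl => exact .refl
  | head hac hcv ih =>
    have hc := fun w => hcv.trans (hv w)
    exact .head ⟨fun w => .head hac (hc w), hc, hac⟩ (ih hc)
end

section
/- Let L be an N×N real matrix, w ∈ ℝ^N a vector with wᵀL = 0 (i.e., vecMul w L = 0), K an m×n real matrix, and c ∈ ℝ. Suppose x : (Fin N × Fin n) → ℝ and f : (Fin N × Fin m) → ℝ satisfy (c • (L ⊗ₖ K)).mulVec x = f, where L ⊗ₖ K denotes the Kronecker product. Then the blockwise weighted sum of f by w vanishes: for every j ∈ Fin m, ∑_{k ∈ Fin N} w k * f (k, j) = 0. -/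
open Matrix Kronecker

/-- If `wᵀ L = 0` and the steady-state equation `(c • (L ⊗ₖ K)).mulVec x = f`
holds, then the blockwise weighted sum of the attack vector `f` by `w`
vanishes: `∑ k, w k * f (k, j) = 0` for every `j`. -/
theorem stmt_3 {N m n : ℕ}
    (L : Matrix (Fin N) (Fin N) ℝ) (w : Fin N → ℝ)
    (hw : Matrix.vecMul w L = 0)
    (K : Matrix (Fin m) (Fin n) ℝ) (c : ℝ)
    (x : Fin N × Fin n → ℝ) (f : Fin N × Fin m → ℝ)
    (hx : (c • (L ⊗ₖ K)).mulVec x = f) :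
    ∀ j : Fin m, ∑ k : Fin N, w k * f (k, j) = 0 := by
  intro j
  have hcol (i : Fin N) : ∑ k, w k * L k i = 0 := congrFun hw i
  subst hx
  simp only [Matrix.mulVec, dotProduct, Matrix.smul_apply, Matrix.kroneckerMap_apply,
    smul_eq_mul, Finset.mul_sum]
  rw [Finset.sum_comm]
  refine Finset.sum_eq_zero fun p _ => ?_
  calc ∑ k, w k * (c * (L k p.1 * K j p.2) * x p)
      = (∑ k, w k * L k p.1) * (c * K j p.2 * x p) := by
        rw [Finset.sum_mul]
        exact Finset.sum_congr rfl fun k _ => by ring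
    _ = 0 := by rw [hcol, zero_mul]
end

section
/- Let μ₁, μ₂ ∈ ℝ and σ₁, σ₂ > 0, define P : ℝ → ℝ by P(q) = (1/(√(2π)·σ₁))·(exp(−(q−μ₁)²/(2σ₁²)) + exp(−(q+μ₁)²/(2σ₁²))), and set ρ₁ = μ₁ − 2μ₂σ₁²/σ₂², ρ₂ = μ₁ + 2μ₂σ₁²/σ₂², ρ₃ = μ₁ − 4μ₂σ₁²/σ₂², ρ₄ = μ₁ + 4μ₂σ₁²/σ₂². Then ∫_ℝ P(q)·(exp(−2qμ₁/σ₁²) − (1/2)·exp(−4qμ₁/σ₁²) − exp(−2qμ₂/σ₂²) + (1/2)·exp(−4qμ₂/σ₂²)) dq = 1 + (1/2)·exp(4μ₁²/σ₁²)·(1 − exp(8μ₁²/σ₁²)) + exp(−μ₁²/(2σ₁²))·((1/2)·(exp(ρ₃²/(2σ₁²)) + exp(ρ₄²/(2σ₁²))) − (exp(ρ₁²/(2σ₁²)) + exp(ρ₂²/(2σ₁²)))). -/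
open Real

open MeasureTheory ProbabilityTheory

lemma gaussian_mul_exp_eq (m t : ℝ) {σ : ℝ} (hσ : 0 < σ) (q : ℝ) :
    1 / (√(2 * π) * σ) * rexp (-(q - m) ^ 2 / (2 * σ ^ 2)) * rexp (t * q)
      = rexp (m * t + σ ^ 2 * t ^ 2 / 2) *
        gaussianPDFReal (m + σ ^ 2 * t) (σ ^ 2).toNNReal q := by
  rw [gaussianPDFReal, Real.coe_toNNReal _ (sq_nonneg σ), Real.sqrt_mul (by positivity) (σ ^ 2),
    Real.sqrt_sq hσ.le, mul_assoc, ← Real.exp_add, mul_left_comm, ← Real.exp_add, one_div]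
  congr 2
  field_simp
  ring

lemma integrable_gaussian_mul_exp (m t : ℝ) {σ : ℝ} (hσ : 0 < σ) :
    Integrable fun q : ℝ ↦
      1 / (√(2 * π) * σ) * rexp (-(q - m) ^ 2 / (2 * σ ^ 2)) * rexp (t * q) := by
  simp_rw [gaussian_mul_exp_eq m t hσ]
  exact (integrable_gaussianPDFReal _ _).const_mul _

lemma integral_gaussian_mul_exp (m t : ℝ) {σ : ℝ} (hσ : 0 < σ) :
    ∫ q : ℝ, 1 / (√(2 * π) * σ) * rexp (-(q - m) ^ 2 / (2 * σ ^ 2)) * rexp (t * q)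
      = rexp (m * t + σ ^ 2 * t ^ 2 / 2) := by
  simp_rw [gaussian_mul_exp_eq m t hσ]
  rw [integral_const_mul, integral_gaussianPDFReal_eq_one _ (by simpa using hσ.ne'), mul_one]

/-- The moment generating function of the folded Gaussian density, extended to the whole line. -/
lemma integral_foldedGaussian_mul_exp (m t : ℝ) {σ : ℝ} (hσ : 0 < σ) :
    ∫ q : ℝ, 1 / (√(2 * π) * σ) *
        (rexp (-(q - m) ^ 2 / (2 * σ ^ 2)) + rexp (-(q + m) ^ 2 / (2 * σ ^ 2))) * rexp (t * q)
      = rexp (m * t + σ ^ 2 * t ^ 2 / 2) + rexp (-m * t + σ ^ 2 * t ^ 2 / 2) := by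
  rw [← integral_gaussian_mul_exp m t hσ, ← integral_gaussian_mul_exp (-m) t hσ,
    ← integral_add (integrable_gaussian_mul_exp m t hσ) (integrable_gaussian_mul_exp (-m) t hσ)]
  simp only [sub_neg_eq_add, mul_add, add_mul]

lemma integrable_foldedGaussian_mul_exp (m t : ℝ) {σ : ℝ} (hσ : 0 < σ) :
    Integrable fun q : ℝ ↦ 1 / (√(2 * π) * σ) *
      (rexp (-(q - m) ^ 2 / (2 * σ ^ 2)) + rexp (-(q + m) ^ 2 / (2 * σ ^ 2))) * rexp (t * q) := by
  have h := (integrable_gaussian_mul_exp m t hσ).add (integrable_gaussian_mul_exp (-m) t hσ)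
  refine h.congr (.of_forall fun q ↦ ?_)
  simp only [Pi.add_apply, sub_neg_eq_add, mul_add, add_mul]


/-- Equation (54) in Appendix A: the exact closed form of the correction term
`T₂` in Lemma 5's KL divergence formula between two univariate folded
Gaussian distributions. -/
theorem stmt_13 (μ₁ μ₂ σ₁ σ₂ : ℝ) (hσ₁ : 0 < σ₁) (hσ₂ : 0 < σ₂) :
    ∫ q : ℝ,
      (1 / (Real.sqrt (2 * π) * σ₁)) *
        (Real.exp (-(q - μ₁) ^ 2 / (2 * σ₁ ^ 2)) + Real.exp (-(q + μ₁) ^ 2 / (2 * σ₁ ^ 2))) *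
        (Real.exp (-(2 * q * μ₁) / σ₁ ^ 2) - (1 / 2) * Real.exp (-(4 * q * μ₁) / σ₁ ^ 2)
          - Real.exp (-(2 * q * μ₂) / σ₂ ^ 2) + (1 / 2) * Real.exp (-(4 * q * μ₂) / σ₂ ^ 2))
      = 1 + (1 / 2) * Real.exp (4 * μ₁ ^ 2 / σ₁ ^ 2) * (1 - Real.exp (8 * μ₁ ^ 2 / σ₁ ^ 2))
        + Real.exp (-μ₁ ^ 2 / (2 * σ₁ ^ 2)) *
          ((1 / 2) * (Real.exp ((μ₁ - 4 * μ₂ * σ₁ ^ 2 / σ₂ ^ 2) ^ 2 / (2 * σ₁ ^ 2))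
              + Real.exp ((μ₁ + 4 * μ₂ * σ₁ ^ 2 / σ₂ ^ 2) ^ 2 / (2 * σ₁ ^ 2)))
            - (Real.exp ((μ₁ - 2 * μ₂ * σ₁ ^ 2 / σ₂ ^ 2) ^ 2 / (2 * σ₁ ^ 2))
              + Real.exp ((μ₁ + 2 * μ₂ * σ₁ ^ 2 / σ₂ ^ 2) ^ 2 / (2 * σ₁ ^ 2)))) := by
  set P : ℝ → ℝ := fun q ↦ 1 / (√(2 * π) * σ₁) *
    (rexp (-(q - μ₁) ^ 2 / (2 * σ₁ ^ 2)) + rexp (-(q + μ₁) ^ 2 / (2 * σ₁ ^ 2))) with hP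
  have hi (t : ℝ) : Integrable fun q ↦ P q * rexp (t * q) :=
    integrable_foldedGaussian_mul_exp μ₁ t hσ₁
  have hv (t : ℝ) : ∫ q, P q * rexp (t * q) =
      rexp (μ₁ * t + σ₁ ^ 2 * t ^ 2 / 2) + rexp (-μ₁ * t + σ₁ ^ 2 * t ^ 2 / 2) :=
    integral_foldedGaussian_mul_exp μ₁ t hσ₁
  have hsplit (a b c d : ℝ) : ∫ q, (P q * rexp (a * q) - 1 / 2 * (P q * rexp (b * q))
      - P q * rexp (c * q) + 1 / 2 * (P q * rexp (d * q)))
      = (∫ q, P q * rexp (a * q)) - 1 / 2 * (∫ q, P q * rexp (b * q))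
        - (∫ q, P q * rexp (c * q)) + 1 / 2 * ∫ q, P q * rexp (d * q) := by
    have hab : Integrable fun q ↦ P q * rexp (a * q) - 1 / 2 * (P q * rexp (b * q)) :=
      (hi a).sub ((hi b).const_mul _)
    have habc : Integrable fun q ↦
        P q * rexp (a * q) - 1 / 2 * (P q * rexp (b * q)) - P q * rexp (c * q) :=
      hab.sub (hi c)
    rw [integral_add habc ((hi d).const_mul _), integral_sub hab (hi c),
      integral_sub (hi a) ((hi b).const_mul _), integral_const_mul, integral_const_mul]
  have hcomplete (t : ℝ) : rexp (μ₁ * t + σ₁ ^ 2 * t ^ 2 / 2) =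
      rexp (-μ₁ ^ 2 / (2 * σ₁ ^ 2)) * rexp ((μ₁ + t * σ₁ ^ 2) ^ 2 / (2 * σ₁ ^ 2)) := by
    rw [← Real.exp_add]
    congr 1
    field_simp
    ring
  have hmain := hsplit (-(2 * μ₁) / σ₁ ^ 2) (-(4 * μ₁) / σ₁ ^ 2)
    (-(2 * μ₂) / σ₂ ^ 2) (-(4 * μ₂) / σ₂ ^ 2)
  simp only [hv] at hmain
  have e₁ : μ₁ * (-(2 * μ₁) / σ₁ ^ 2) + σ₁ ^ 2 * (-(2 * μ₁) / σ₁ ^ 2) ^ 2 / 2 = 0 := by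
    field_simp
    ring
  have e₂ : -μ₁ * (-(2 * μ₁) / σ₁ ^ 2) + σ₁ ^ 2 * (-(2 * μ₁) / σ₁ ^ 2) ^ 2 / 2
      = 4 * μ₁ ^ 2 / σ₁ ^ 2 := by
    field_simp
    ring
  have e₃ : μ₁ * (-(4 * μ₁) / σ₁ ^ 2) + σ₁ ^ 2 * (-(4 * μ₁) / σ₁ ^ 2) ^ 2 / 2
      = 4 * μ₁ ^ 2 / σ₁ ^ 2 := by
    field_simp
    ring
  have e₄ : -μ₁ * (-(4 * μ₁) / σ₁ ^ 2) + σ₁ ^ 2 * (-(4 * μ₁) / σ₁ ^ 2) ^ 2 / 2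
      = 4 * μ₁ ^ 2 / σ₁ ^ 2 + 8 * μ₁ ^ 2 / σ₁ ^ 2 := by
    field_simp
    ring
  have hreflect (t : ℝ) : rexp (-μ₁ * t + σ₁ ^ 2 * t ^ 2 / 2) =
      rexp (μ₁ * -t + σ₁ ^ 2 * (-t) ^ 2 / 2) := by
    congr 1
    ring
  rw [e₁, e₂, e₃, e₄, Real.exp_zero, Real.exp_add, hreflect (-(2 * μ₂) / σ₂ ^ 2),
    hreflect (-(4 * μ₂) / σ₂ ^ 2)] at hmain
  simp only [hcomplete] at hmain
  have s₁ (k : ℝ) : μ₁ + -(k * μ₂) / σ₂ ^ 2 * σ₁ ^ 2 = μ₁ - k * μ₂ * σ₁ ^ 2 / σ₂ ^ 2 := by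
    ring
  have s₂ (k : ℝ) : μ₁ + -(-(k * μ₂) / σ₂ ^ 2) * σ₁ ^ 2 = μ₁ + k * μ₂ * σ₁ ^ 2 / σ₂ ^ 2 := by
    ring
  rw [s₁, s₁, s₂, s₂] at hmain
  have hexp (k μ σ q : ℝ) : -(k * q * μ) / σ ^ 2 = -(k * μ) / σ ^ 2 * q := by
    ring
  simp only [hexp]
  trans
  · refine (integral_congr_ae (.of_forall fun q ↦ ?_)).trans hmain
    simp only [hP]
    ring
  · ring
end
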